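/- arXiv:1711.00948 — 4 statements merged into one kernel-verified Lean document; each statement's English description precedes it below -/
import Mathlib

section
/- For every K ≥ 1 there exists C > 0 depending only on K with the following property. Assume f : ℝ³ × ℝ × ℝ³ → ℝ is of class C² with f ≥ 1/K everywhere and with |f| and all partial derivatives of f up to order 2 bounded by K; u : ℝ³ → ℝ is C^∞ on B₁₀ with σ₂(D²u(x)) = f(x, u(x), Du(x)) and Δu(x) > 0 on B₁₀; and |u(x)| + |Du(x)| ≤ K on B₁₀. Set b := log Δu. Then at every x ∈ B₁₀: Σ_{i,j} σ₂^{ij}(x) ∂_i∂_j b(x) ≥ (1/100)·Σ_{i,j} σ₂^{ij}(x) ∂_i b(x) ∂_j b(x) − C·Δu(x) + Σ_i f_{u_i}(x) ∂_i b(x). -/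
open Metric MeasureTheory Real

noncomputable section

abbrev E3 : Type := EuclideanSpace ℝ (Fin 3)

/-- The `i`-th partial derivative of `u`. -/
def pd (i : Fin 3) (u : E3 → ℝ) : E3 → ℝ :=
  fun x => fderiv ℝ u x (EuclideanSpace.single i 1)

/-- The gradient `Du` of `u` as a vector in `ℝ³`. -/
def grad (u : E3 → ℝ) (x : E3) : E3 :=
  (WithLp.equiv 2 (Fin 3 → ℝ)).symm (fun i => pd i u x)

/-- The Hessian matrix `D²u`. -/
def hess (u : E3 → ℝ) (x : E3) : Matrix (Fin 3) (Fin 3) ℝ :=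
  Matrix.of fun i j => pd i (pd j u) x

/-- The Laplacian `Δu`. -/
def lap (u : E3 → ℝ) (x : E3) : ℝ := ∑ i, hess u x i i

def sigma1 (A : Matrix (Fin 3) (Fin 3) ℝ) : ℝ := A.trace

def sigma2 (A : Matrix (Fin 3) (Fin 3) ℝ) : ℝ := (A.trace ^ 2 - (A * A).trace) / 2

def sigma3 (A : Matrix (Fin 3) (Fin 3) ℝ) : ℝ := A.det

/-- The matrix `σ₂^{ij}(x) = Δu(x) δ_{ij} - ∂_i∂_j u(x)`. -/
def sg (u : E3 → ℝ) (x : E3) : Matrix (Fin 3) (Fin 3) ℝ :=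
  lap u x • (1 : Matrix (Fin 3) (Fin 3) ℝ) - hess u x

/-- `f_{u_p}`: the partial derivative of `f` in its `p`-th gradient variable,
evaluated at `(x, u(x), Du(x))`. -/
def fp (f : E3 × ℝ × E3 → ℝ) (u : E3 → ℝ) (p : Fin 3) (x : E3) : ℝ :=
  fderiv ℝ f (x, u x, grad u x) (0, 0, EuclideanSpace.single p 1)

/-- The standing hypotheses: `f` is `C²`, bounded below by `1/K`, with `|f|` and all
derivatives up to order 2 bounded by `K`; `u` is smooth on `B₁₀`, solves
`σ₂(D²u) = f(x,u,Du)` with `Δu > 0` on `B₁₀`, and `|u| + |Du| ≤ K` on `B₁₀`. -/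
def Hyp (K : ℝ) (f : E3 × ℝ × E3 → ℝ) (u : E3 → ℝ) : Prop :=
  ContDiff ℝ 2 f ∧
  (∀ z, 1 / K ≤ f z) ∧
  (∀ z, ∀ k : ℕ, k ≤ 2 → ‖iteratedFDeriv ℝ k f z‖ ≤ K) ∧
  ContDiffOn ℝ (⊤ : ℕ∞) u (ball (0 : E3) 10) ∧
  (∀ x ∈ ball (0 : E3) 10, sigma2 (hess u x) = f (x, u x, grad u x)) ∧
  (∀ x ∈ ball (0 : E3) 10, 0 < lap u x) ∧
  (∀ x ∈ ball (0 : E3) 10, |u x| + ‖grad u x‖ ≤ K)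

lemma alg_coef (a : ℝ) (ha : 0 < a) (ha2 : a ≤ 4/3) :
    (1 + 101/100*a) * (1 - 4*a/(3*(1+a^2)) + (2*a/100)/(1+a^2)) ≤ 1 := by
  have hpos : 0 < 1 + a^2 := by positivity
  have e : (1 + 101/100*a) * (1 - 4*a/(3*(1+a^2)) + (2*a/100)/(1+a^2)) - 1
      = a * (101/100*(1+a^2) - (4/3-1/50)*(1+101/100*a)) / (1+a^2) := by
    field_simp
    ring
  have : a * (101/100*(1+a^2) - (4/3-1/50)*(1+101/100*a)) / (1+a^2) ≤ 0 := by
    apply div_nonpos_of_nonpos_of_nonneg _ hpos.le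
    apply mul_nonpos_of_nonneg_of_nonpos ha.le
    nlinarith
  linarith

lemma alg_m (a : ℝ) : ((1+a)/(1+a^2))^2 ≤ 2/(1+a^2) := by
  have hpos : 0 < 1 + a^2 := by positivity
  rw [div_pow, div_le_div_iff₀ (by positivity) (by positivity)]
  nlinarith [mul_nonneg hpos.le (sq_nonneg (1-a))]

/-- One-direction inequality, normalised. -/
lemma alg_norm (a b c x y z : ℝ) (ha : 0 < a) (ha2 : a ≤ 4/3) (hs : a + b + c = 2)
    (hq : a^2 + b^2 + c^2 ≤ 2) :
    (1 + 101/100*a) * (x+y+z)^2 ≤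
      x^2 + 3*y^2 + 3*z^2 + (100/a) * (a*x+b*y+c*z)^2 := by
  set h := a*x+b*y+c*z with hh
  set m := (1+a)/(1+a^2) with hm
  have hpos : 0 < 1 + a^2 := by positivity
  have hmm : m * (1+a^2) = 1 + a := by rw [hm]; field_simp
  set N := x^2 + 3*y^2 + 3*z^2 + (100/a) * h^2 with hN
  have hN0 : 0 ≤ N := by positivity
  set B := (1-m*a)^2 + (1-m*b)^2/3 + (1-m*c)^2/3 + m^2*a/100 with hB
  have hid : x+y+z = (1-m*a)*x + (1-m*b)*y + (1-m*c)*z + m*h := by rw [hh]; ring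
  -- Cauchy-Schwarz
  have hcs : (x+y+z)^2 ≤ B * N := by
    have key : B * N - (x+y+z)^2 =
        3*((1-m*a)*y - (1-m*b)*x/3)^2 + 3*((1-m*a)*z - (1-m*c)*x/3)^2
        + ((1-m*b)*z-(1-m*c)*y)^2
        + (100/a) * ((1-m*a)*h - (m*a/100)*x)^2
        + (100/a)/3 * ((1-m*b)*h - 3*(m*a/100)*y)^2
        + (100/a)/3 * ((1-m*c)*h - 3*(m*a/100)*z)^2 := by
      rw [hid, hB, hN]
      clear_value h m
      field_simp
      ring
    have : 0 ≤ B * N - (x+y+z)^2 := by rw [key]; positivity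
    linarith
  have hB1 : B ≤ 1 - 4*a/(3*(1+a^2)) + m^2*a/100 := by
    have e1 : B = 5/3 - 2*m*(2+2*a)/3 + m^2*(a^2 + (b^2+c^2)/3) + m^2*a/100 := by
      rw [hB]
      have : c = 2 - a - b := by linarith
      subst this; ring
    have e2 : m^2*(a^2 + (b^2+c^2)/3) ≤ m^2*((2+2*a^2)/3) := by
      apply mul_le_mul_of_nonneg_left _ (sq_nonneg m); linarith
    have e3 : 5/3 - 2*m*(2+2*a)/3 + m^2*((2+2*a^2)/3) = 1 - 4*a/(3*(1+a^2)) := by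
      rw [hm]; field_simp; ring
    linarith
  have hB2 : (1 + 101/100*a) * (1 - 4*a/(3*(1+a^2)) + m^2*a/100) ≤ 1 := by
    have hm2 : m^2 ≤ 2/(1+a^2) := alg_m a
    have : m^2*a/100 ≤ (2*a/100)/(1+a^2) := by
      calc m^2*a/100 ≤ 2/(1+a^2)*a/100 := by gcongr
        _ = _ := by field_simp
    have h2 := alg_coef a ha ha2
    refine le_trans ?_ h2
    gcongr
  have h1a : 0 ≤ 1 + 101/100*a := by positivity
  calc (1 + 101/100*a) * (x+y+z)^2 ≤ (1 + 101/100*a) * (B*N) := by gcongr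
    _ = ((1 + 101/100*a) * B) * N := by ring
    _ ≤ 1 * N := by
      gcongr
      exact le_trans (mul_le_mul_of_nonneg_left hB1 h1a) hB2
    _ = N := one_mul _

/-- One-direction inequality. `p` plays the role of `λ_k`. -/
lemma alg_dir (p q r s f x y z : ℝ) (hs : s = p + q + r) (hs0 : 0 < s) (hf : 0 < f)
    (hfe : p*q + p*r + q*r = f) :
    -(100/f) * ((s-p)*x+(s-q)*y+(s-r)*z)^2 ≤
      x^2 + 3*y^2 + 3*z^2 - (x+y+z)^2 - (101/100)/s * ((s-p) * (x+y+z)^2) := by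
  have hps : f ≤ s * (s-p) := by subst hs; nlinarith [sq_nonneg (q-r), sq_nonneg (q+r)]
  have hp : 0 < s - p := by
    by_contra hc
    have : s * (s-p) ≤ 0 := mul_nonpos_of_nonneg_of_nonpos hs0.le (by linarith)
    linarith
  have hss : 0 < s^2 := by positivity
  have h := alg_norm ((s-p)/s) ((s-q)/s) ((s-r)/s) x y z (by positivity)
    (by rw [div_le_div_iff₀ hs0 (by norm_num)]
        by_contra hc
        push Not at hc
        subst hs
        nlinarith [sq_nonneg (q-r)])
    (by field_simp; linarith)
    (by
      rw [div_pow, div_pow, div_pow, ← add_div, ← add_div, div_le_iff₀ hss]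
      subst hs; nlinarith)
  have e1 : (s-p)/s*x + (s-q)/s*y + (s-r)/s*z = ((s-p)*x+(s-q)*y+(s-r)*z)/s := by
    field_simp
  rw [e1] at h
  set g := (s-p)*x+(s-q)*y+(s-r)*z
  have e2 : 100/((s-p)/s) * (g/s)^2 = 100/(s*(s-p)) * g^2 := by field_simp
  rw [e2] at h
  have e3 : 100/(s*(s-p)) * g^2 ≤ 100/f*g^2 := by gcongr
  have e4 : (1 + 101/100*((s-p)/s)) * (x+y+z)^2 =
    (x+y+z)^2 + (101/100)/s * ((s-p) * (x+y+z)^2) := by field_simp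
  rw [e4] at h
  linarith

/-- diagonal case -/
lemma alg_diag (l : Fin 3 → ℝ) (T : Fin 3 → Fin 3 → Fin 3 → ℝ) (s f : ℝ)
    (hT1 : ∀ i j k, T i j k = T j i k) (hT2 : ∀ i j k, T i j k = T i k j)
    (hs : s = ∑ i, l i) (hs0 : 0 < s) (hf : 0 < f)
    (hfe : s^2 - ∑ i, (l i)^2 = 2*f) :
    -(100/f) * ∑ k, (∑ i, (s - l i) * T i i k)^2 ≤
      ∑ i, ∑ j, ∑ k, (T i j k)^2 - ∑ k, (∑ i, T i i k)^2
        - (101/100)/s * ∑ k, (s - l k) * (∑ i, T i i k)^2 := by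
  simp only [Fin.sum_univ_three] at *
  have hf1 : l 0 * l 1 + l 0 * l 2 + l 1 * l 2 = f := by rw [hs] at hfe; linarith
  have a0 := alg_dir (l 0) (l 1) (l 2) s f (T 0 0 0) (T 1 1 0) (T 2 2 0) hs hs0 hf hf1
  have a1 := alg_dir (l 1) (l 0) (l 2) s f (T 1 1 1) (T 0 0 1) (T 2 2 1) (by linarith) hs0 hf (by linarith)
  have a2 := alg_dir (l 2) (l 0) (l 1) s f (T 2 2 2) (T 0 0 2) (T 1 1 2) (by linarith) hs0 hf (by linarith)
  have t1 : T 0 1 0 = T 0 0 1 := hT2 _ _ _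
  have t2 : T 1 0 0 = T 0 0 1 := by rw [hT1, t1]
  have t3 : T 0 2 0 = T 0 0 2 := hT2 _ _ _
  have t4 : T 2 0 0 = T 0 0 2 := by rw [hT1, t3]
  have t5 : T 1 0 1 = T 1 1 0 := hT2 _ _ _
  have t6 : T 0 1 1 = T 1 1 0 := by rw [hT1, t5]
  have t7 : T 1 2 1 = T 1 1 2 := hT2 _ _ _
  have t8 : T 2 1 1 = T 1 1 2 := by rw [hT1, t7]
  have t9 : T 2 0 2 = T 2 2 0 := hT2 _ _ _
  have t10 : T 0 2 2 = T 2 2 0 := by rw [hT1, t9]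
  have t11 : T 2 1 2 = T 2 2 1 := hT2 _ _ _
  have t12 : T 1 2 2 = T 2 2 1 := by rw [hT1, t11]
  rw [t1,t2,t3,t4,t5,t6,t7,t8,t9,t10,t11,t12]
  have p1 := sq_nonneg (T 0 1 2)
  have p2 := sq_nonneg (T 0 2 1)
  have p3 := sq_nonneg (T 1 0 2)
  have p4 := sq_nonneg (T 1 2 0)
  have p5 := sq_nonneg (T 2 0 1)
  have p6 := sq_nonneg (T 2 1 0)
  have := add_le_add (add_le_add a0 a1) a2
  linarith

lemma orth_sq (P : Matrix (Fin 3) (Fin 3) ℝ) (hP : ∀ i j, ∑ a, P i a * P j a = if i = j then 1 else 0)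
    (v : Fin 3 → ℝ) : ∑ a, (∑ i, P i a * v i)^2 = ∑ i, (v i)^2 := by
  have h : ∀ i j, ∑ a, P i a * P j a = if i = j then 1 else 0 := hP
  have h00 := h 0 0; have h01 := h 0 1; have h02 := h 0 2
  have h11 := h 1 1; have h12 := h 1 2; have h22 := h 2 2
  simp [Fin.sum_univ_three] at h00 h01 h02 h11 h12 h22 ⊢
  linear_combination (v 0)^2 * h00 + (v 1)^2*h11 + (v 2)^2*h22 + 2*v 0*v 1*h01 + 2*v 0 * v 2*h02 + 2*v 1*v 2*h12

/-- general case -/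
lemma alg_gen (H : Matrix (Fin 3) (Fin 3) ℝ) (hH : ∀ i j, H i j = H j i)
    (T : Fin 3 → Fin 3 → Fin 3 → ℝ) (s f : ℝ)
    (hT1 : ∀ i j k, T i j k = T j i k) (hT2 : ∀ i j k, T i j k = T i k j)
    (hs : s = ∑ i, H i i) (hs0 : 0 < s) (hf : 0 < f)
    (hfe : s^2 - ∑ i, ∑ j, (H i j)^2 = 2*f) :
    -(100/f) * ∑ k, (∑ i, ∑ j, (s • (1 : Matrix (Fin 3) (Fin 3) ℝ) - H) i j * T i j k)^2 ≤
      ∑ i, ∑ j, ∑ k, (T i j k)^2 - ∑ k, (∑ i, T i i k)^2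
        - (101/100)/s * ∑ i, ∑ j, (s • (1 : Matrix (Fin 3) (Fin 3) ℝ) - H) i j *
            (∑ a, T a a i) * (∑ a, T a a j) := by
  have hherm : H.IsHermitian := by
    ext i j; simp [hH i j]
  obtain ⟨P, l, hP, hHP⟩ : ∃ (P : Matrix (Fin 3) (Fin 3) ℝ) (l : Fin 3 → ℝ),
      P * P.transpose = 1 ∧ H = P * Matrix.diagonal l * P.transpose := by
    refine ⟨hherm.eigenvectorUnitary, hherm.eigenvalues, ?_, ?_⟩
    · have := (Matrix.mem_unitaryGroup_iff (A := (hherm.eigenvectorUnitary : Matrix (Fin 3) (Fin 3) ℝ))).1 hherm.eigenvectorUnitary.2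
      simpa [Matrix.star_eq_conjTranspose] using this
    · have := hherm.spectral_theorem
      conv_lhs => rw [this]
      simp [Unitary.conjStarAlgAut_apply, Matrix.star_eq_conjTranspose]
  have hP1 : ∀ i j, ∑ a, P i a * P j a = if i = j then 1 else 0 := by
    intro i j
    have := congrFun (congrFun hP i) j
    simpa [Matrix.mul_apply, Matrix.one_apply] using this
  have hP2' : P.transpose * P = 1 := mul_eq_one_comm.1 hP
  have hP2 : ∀ a b, ∑ i, P i a * P i b = if a = b then 1 else 0 := by
    intro i j
    have := congrFun (congrFun hP2' i) j
    simpa [Matrix.mul_apply, Matrix.one_apply] using this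
  have hHe : ∀ i j, H i j = ∑ a, l a * (P i a * P j a) := by
    intro i j
    rw [hHP, Matrix.mul_apply]
    simp only [Matrix.mul_diagonal, Matrix.transpose_apply]
    exact Finset.sum_congr rfl fun a _ => by ring
  have hSe : ∀ i j, (s • (1 : Matrix (Fin 3) (Fin 3) ℝ) - H) i j = ∑ a, (s - l a) * (P i a * P j a) := by
    intro i j
    simp only [sub_mul, Finset.sum_sub_distrib, ← Finset.mul_sum, hP1, Matrix.sub_apply,
      Matrix.smul_apply, Matrix.one_apply, smul_eq_mul]
    rw [hHe]
  set T' : Fin 3 → Fin 3 → Fin 3 → ℝ := fun a b c =>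
    ∑ k, P k c * ∑ j, P j b * ∑ i, P i a * T i j k with hT'
  have ht' : ∀ (w : Fin 3 → ℝ) c, ∑ a, w a * T' a a c =
      ∑ k, P k c * ∑ i, ∑ j, (∑ a, w a * (P i a * P j a)) * T i j k := by
    intro w c
    simp only [hT', Fin.sum_univ_three]
    ring
  have htr : ∀ c, ∑ a, T' a a c = ∑ k, P k c * ∑ i, T i i k := by
    intro c
    have := ht' (fun _ => 1) c
    simp only [one_mul, hP1, ite_mul, zero_mul, Finset.sum_ite_eq, Finset.mem_univ, if_true] at this
    exact this
  have hg : ∀ c, ∑ a, (s - l a) * T' a a c = ∑ k, P k c * ∑ i, ∑ j, (s • (1 : Matrix (Fin 3) (Fin 3) ℝ) - H) i j * T i j k := by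
    intro c
    rw [ht']
    simp only [hSe]
  have hsl : s = ∑ i, l i := by
    rw [hs]
    simp only [hHe]
    rw [Finset.sum_comm]
    simp only [← Finset.mul_sum, hP2, if_true, mul_one]
  have hll : ∑ i, ∑ j, (H i j)^2 = ∑ i, (l i)^2 := by
    have e1 : ∑ i, ∑ j, (H i j)^2 = (H * H).trace := by
      simp only [Matrix.trace, Matrix.diag, Matrix.mul_apply]
      exact Finset.sum_congr rfl fun i _ => Finset.sum_congr rfl fun j _ => by rw [hH j i]; ring
    rw [e1]
    have e2 : H * H = P * (Matrix.diagonal l * Matrix.diagonal l) * P.transpose := by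
      rw [hHP]
      calc _ = P * Matrix.diagonal l * (P.transpose * P) * Matrix.diagonal l * P.transpose := by
            simp only [Matrix.mul_assoc]
        _ = _ := by rw [hP2']; simp only [Matrix.mul_assoc, Matrix.one_mul]
    rw [e2, Matrix.trace_mul_comm, ← Matrix.mul_assoc, hP2', Matrix.one_mul, Matrix.diagonal_mul_diagonal,
      Matrix.trace_diagonal]
    exact Finset.sum_congr rfl fun i _ => by ring
  have hsq : ∑ i, ∑ j, ∑ k, (T' i j k)^2 = ∑ i, ∑ j, ∑ k, (T i j k)^2 := by
    have s1 : ∀ a b, ∑ c, (T' a b c)^2 = ∑ k, (∑ j, P j b * ∑ i, P i a * T i j k)^2 :=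
      fun a b => orth_sq P hP1 (fun k => ∑ j, P j b * ∑ i, P i a * T i j k)
    simp only [s1]
    have s2 : ∀ a, ∑ b, ∑ k, (∑ j, P j b * ∑ i, P i a * T i j k)^2 = ∑ k, ∑ j, (∑ i, P i a * T i j k)^2 := by
      intro a
      rw [Finset.sum_comm]
      exact Finset.sum_congr rfl fun k _ => orth_sq P hP1 (fun j => ∑ i, P i a * T i j k)
    simp only [s2]
    have s3 : ∀ j k, ∑ a, (∑ i, P i a * T i j k)^2 = ∑ i, (T i j k)^2 :=
      fun j k => orth_sq P hP1 (fun i => T i j k)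
    calc _ = ∑ k, ∑ j, ∑ a, (∑ i, P i a * T i j k)^2 := by
            rw [Finset.sum_comm]
            exact Finset.sum_congr rfl fun k _ => Finset.sum_comm
      _ = ∑ k, ∑ j, ∑ i, (T i j k)^2 := by simp only [s3]
      _ = _ := by simp only [Fin.sum_univ_three]; ring
  have hmain := alg_diag l T' s f
    (by intro a b c
        simp only [hT', Fin.sum_univ_three]
        rw [hT1 1 0, hT1 2 0, hT1 2 1, hT1 1 0, hT1 2 0, hT1 2 1, hT1 1 0, hT1 2 0, hT1 2 1]
        ring)
    (by intro a b c
        have e : ∀ i j k, T i j k = T i k j := hT2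
        simp only [hT', Fin.sum_univ_three]
        rw [hT2 0 1 0, hT2 0 2 0, hT2 0 2 1, hT2 1 1 0, hT2 1 2 0, hT2 1 2 1, hT2 2 1 0, hT2 2 2 0, hT2 2 2 1]
        ring)
    hsl hs0 hf (by rw [← hll]; exact hfe)
  simp only [hg, htr] at hmain
  rw [hsq, orth_sq P hP1, orth_sq P hP1] at hmain
  have hfin : ∑ k, (s - l k) * (∑ i, P i k * ∑ a, T a a i)^2 =
      ∑ i, ∑ j, (s • (1 : Matrix (Fin 3) (Fin 3) ℝ) - H) i j * (∑ a, T a a i) * (∑ a, T a a j) := by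
    simp only [hSe]
    generalize (fun i => ∑ a, T a a i) = t
    have : ∀ t : Fin 3 → ℝ, ∑ k, (s - l k) * (∑ i, P i k * t i)^2 =
      ∑ i, ∑ j, (∑ a, (s - l a) * (P i a * P j a)) * t i * t j := by
      intro t
      simp only [Fin.sum_univ_three]; ring
    exact this (fun i => ∑ a, T a a i)
  rw [hfin] at hmain
  exact hmain
/-- Smoothness on the ball. -/
def Sm (g : E3 → ℝ) : Prop := ContDiffOn ℝ (⊤ : ℕ∞) g (ball (0 : E3) 10)

lemma Sm.pd {g : E3 → ℝ} (hg : Sm g) (i : Fin 3) : Sm (pd i g) := by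
  have h1 : ContDiffOn ℝ (⊤ : ℕ∞) (fderiv ℝ g) (ball (0 : E3) 10) :=
    ContDiffOn.fderiv_of_isOpen hg isOpen_ball (by simp)
  exact h1.clm_apply contDiffOn_const

lemma Sm.diff {g : E3 → ℝ} (hg : Sm g) {x : E3} (hx : x ∈ ball (0 : E3) 10) :
    DifferentiableAt ℝ g x :=
  (ContDiffOn.contDiffAt hg (isOpen_ball.mem_nhds hx)).differentiableAt (by simp)

lemma pd_congr {g h : E3 → ℝ} (hgh : ∀ y ∈ ball (0 : E3) 10, g y = h y) (i : Fin 3) :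
    ∀ y ∈ ball (0 : E3) 10, pd i g y = pd i h y := by
  intro y hy
  have : g =ᶠ[nhds y] h := Filter.eventually_of_mem (isOpen_ball.mem_nhds hy) hgh
  simp only [pd, this.fderiv_eq]

lemma pd_comm {g : E3 → ℝ} (hg : Sm g) (i j : Fin 3) :
    ∀ y ∈ ball (0 : E3) 10, pd i (pd j g) y = pd j (pd i g) y := by
  intro y hy
  have hc : ContDiffAt ℝ (⊤ : ℕ∞) g y := ContDiffOn.contDiffAt hg (isOpen_ball.mem_nhds hy)
  have hsym : IsSymmSndFDerivAt ℝ g y := by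
    apply hc.isSymmSndFDerivAt
    rw [minSmoothness_of_isRCLikeNormedField]
    exact WithTop.coe_le_coe.2 (le_top : (2 : ℕ∞) ≤ ⊤)
  have hd : DifferentiableAt ℝ (fderiv ℝ g) y := by
    have h1 : ContDiffOn ℝ (⊤ : ℕ∞) (fderiv ℝ g) (ball (0 : E3) 10) :=
      ContDiffOn.fderiv_of_isOpen hg isOpen_ball (by simp)
    exact (h1.contDiffAt (isOpen_ball.mem_nhds hy)).differentiableAt (by simp)
  have e : ∀ a b : Fin 3, pd a (pd b g) y =
      fderiv ℝ (fderiv ℝ g) y (EuclideanSpace.single a 1) (EuclideanSpace.single b 1) := by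
    intro a b
    change fderiv ℝ (fun z => fderiv ℝ g z (EuclideanSpace.single b 1)) y _ = _
    rw [fderiv_clm_apply hd (differentiableAt_const _)]
    simp
  rw [e, e]
  exact hsym _ _

lemma pd_sum3 {q : Fin 3 → E3 → ℝ} {x : E3} (hq : ∀ i, DifferentiableAt ℝ (q i) x) (k : Fin 3) :
    pd k (fun y => ∑ i, q i y) x = ∑ i, pd k (q i) x := by
  simp only [pd]
  rw [fderiv_fun_sum (fun i _ => hq i)]
  simp

lemma pd_mul {g h : E3 → ℝ} {x : E3} (hg : DifferentiableAt ℝ g x) (hh : DifferentiableAt ℝ h x)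
    (k : Fin 3) : pd k (fun y => g y * h y) x = g x * pd k h x + h x * pd k g x := by
  simp only [pd]
  rw [fderiv_fun_mul hg hh]
  simp

lemma pd_sub {g h : E3 → ℝ} {x : E3} (hg : DifferentiableAt ℝ g x) (hh : DifferentiableAt ℝ h x)
    (k : Fin 3) : pd k (fun y => g y - h y) x = pd k g x - pd k h x := by
  simp only [pd]
  rw [fderiv_fun_sub hg hh]
  simp

lemma lap_eq (u : E3 → ℝ) : lap u = fun y => ∑ i, pd i (pd i u) y := by
  ext y; simp [lap, hess]

lemma Sm.lap {u : E3 → ℝ} (hu : Sm u) : Sm (lap u) := by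
  rw [lap_eq]
  exact ContDiffOn.sum fun i _ => (hu.pd i).pd i

/-- first derivatives of log -/
lemma pd_log {w : E3 → ℝ} (hw : Sm w) (hpos : ∀ y ∈ ball (0 : E3) 10, 0 < w y) (i : Fin 3) :
    ∀ y ∈ ball (0 : E3) 10, pd i (fun z => Real.log (w z)) y = (w y)⁻¹ * pd i w y := by
  intro y hy
  simp only [pd]
  rw [fderiv.log (hw.diff hy) (hpos y hy).ne']
  simp

lemma pd_log2 {w : E3 → ℝ} (hw : Sm w) (hpos : ∀ y ∈ ball (0 : E3) 10, 0 < w y) (i j : Fin 3) :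
    ∀ y ∈ ball (0 : E3) 10, pd i (pd j (fun z => Real.log (w z))) y =
      (w y)⁻¹ * pd i (pd j w) y - (w y)⁻¹ ^ 2 * pd i w y * pd j w y := by
  intro y hy
  rw [pd_congr (pd_log hw hpos j) i y hy]
  have hd := (hw.diff hy)
  have hinv : DifferentiableAt ℝ (fun z => (w z)⁻¹) y := hd.inv (hpos y hy).ne'
  rw [pd_mul hinv ((hw.pd j).diff hy)]
  have : pd i (fun z => (w z)⁻¹) y = - (w y)⁻¹ ^ 2 * pd i w y := by
    simp only [pd]
    have h := (hasDerivAt_inv (hpos y hy).ne').comp_hasFDerivAt y hd.hasFDerivAt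
    have h2 : HasFDerivAt (fun z => (w z)⁻¹) (-(w y ^ 2)⁻¹ • fderiv ℝ w y) y := h
    rw [h2.fderiv]
    simp
  rw [this]
  ring

/-- first derivative of the quadratic expression -/
lemma pd_quad {w : E3 → ℝ} {h : Fin 3 → Fin 3 → E3 → ℝ} (hw : Sm w) (hh : ∀ i j, Sm (h i j))
    (k : Fin 3) : ∀ y ∈ ball (0 : E3) 10,
    pd k (fun z => (1/2) * (w z * w z - ∑ i, ∑ j, h i j z * h i j z)) y =
      w y * pd k w y - ∑ i, ∑ j, h i j y * pd k (h i j) y := by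
  intro y hy
  have dw := hw.diff hy
  have dh := fun i j => (hh i j).diff hy
  have d1 : ∀ i j, DifferentiableAt ℝ (fun z => h i j z * h i j z) y := fun i j =>
    (dh i j).mul (dh i j)
  have d2 : ∀ i, DifferentiableAt ℝ (fun z => ∑ j, h i j z * h i j z) y := fun i =>
    DifferentiableAt.fun_sum fun j _ => d1 i j
  have d3 := DifferentiableAt.fun_sum (u := Finset.univ) fun i _ => d2 i
  have d0 : pd k (fun _ => (1/2 : ℝ)) y = 0 := by simp [pd]
  rw [pd_mul (differentiableAt_const _) ((dw.fun_mul dw).fun_sub d3), d0, pd_sub (dw.fun_mul dw) (DifferentiableAt.fun_sum fun i _ => d2 i), pd_mul dw dw, pd_sum3 d2]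
  simp only [pd_sum3 (d1 _), pd_mul (dh _ _) (dh _ _)]
  simp only [Fin.sum_univ_three]
  ring

lemma pd_quad2 {w : E3 → ℝ} {h : Fin 3 → Fin 3 → E3 → ℝ} (hw : Sm w) (hh : ∀ i j, Sm (h i j))
    (k : Fin 3) : ∀ y ∈ ball (0 : E3) 10,
    pd k (fun z => w z * pd k w z - ∑ i, ∑ j, h i j z * pd k (h i j) z) y =
      w y * pd k (pd k w) y + (pd k w y)^2
        - ∑ i, ∑ j, (h i j y * pd k (pd k (h i j)) y + (pd k (h i j) y)^2) := by
  intro y hy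
  have dw := hw.diff hy
  have dw2 := (hw.pd k).diff hy
  have dh := fun i j => (hh i j).diff hy
  have dh2 := fun i j => ((hh i j).pd k).diff hy
  have d1 : ∀ i j, DifferentiableAt ℝ (fun z => h i j z * pd k (h i j) z) y := fun i j =>
    (dh i j).mul (dh2 i j)
  have d2 : ∀ i, DifferentiableAt ℝ (fun z => ∑ j, h i j z * pd k (h i j) z) y := fun i =>
    DifferentiableAt.fun_sum fun j _ => d1 i j
  rw [pd_sub (dw.fun_mul dw2) (DifferentiableAt.fun_sum fun i _ => d2 i), pd_mul dw dw2, pd_sum3 d2]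
  simp only [pd_sum3 (d1 _), pd_mul (dh _ _) (dh2 _ _)]
  simp only [Fin.sum_univ_three]
  ring

/-- vector with given coordinates -/
def vec (q : Fin 3 → ℝ) : E3 := ∑ p, q p • EuclideanSpace.single p (1 : ℝ)

lemma vec_apply (q : Fin 3 → ℝ) (p : Fin 3) : vec q p = q p := by
  fin_cases p <;> simp [vec, Fin.sum_univ_three]

lemma norm_vec_sq (q : Fin 3 → ℝ) : ‖vec q‖^2 = ∑ p, (q p)^2 := by
  rw [EuclideanSpace.norm_sq_eq]
  simp [vec_apply]

lemma grad_eq (u : E3 → ℝ) (x : E3) : grad u x = vec (fun p => pd p u x) := by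
  ext p
  rw [vec_apply]
  simp [grad]

lemma hasFDerivAt_vec {q : Fin 3 → E3 → ℝ} {x : E3} (hq : ∀ p, DifferentiableAt ℝ (q p) x) :
    HasFDerivAt (fun y => vec (fun p => q p y))
      (∑ p, (fderiv ℝ (q p) x).smulRight (EuclideanSpace.single p (1 : ℝ))) x := by
  unfold vec
  exact HasFDerivAt.fun_sum fun p _ => (hq p).hasFDerivAt.smul_const _

/-- the direction `∂_k (x, u, Du)` -/
def Vk (u : E3 → ℝ) (k : Fin 3) (y : E3) : E3 × ℝ × E3 :=
  (EuclideanSpace.single k 1, pd k u y, vec fun p => pd k (pd p u) y)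

lemma pd_comp {f : E3 × ℝ × E3 → ℝ} (hf : ContDiff ℝ 2 f) {u : E3 → ℝ} (hu : Sm u) (k : Fin 3) :
    ∀ y ∈ ball (0 : E3) 10, pd k (fun z => f (z, u z, grad u z)) y =
      fderiv ℝ f (y, u y, grad u y) (Vk u k y) := by
  intro y hy
  have h3 := hasFDerivAt_vec (fun p => (hu.pd p).diff hy)
  have h := (hasFDerivAt_id y).prodMk ((hu.diff hy).hasFDerivAt.prodMk h3)
  have hfd : HasFDerivAt f (fderiv ℝ f (y, u y, grad u y)) (y, u y, grad u y) :=
    (hf.differentiable (by norm_num) _).hasFDerivAt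
  simp only [grad_eq] at hfd ⊢
  have hc := hfd.comp y h
  have hc2 : HasFDerivAt (fun z => f (z, u z, vec fun p => pd p u z)) _ y := hc
  simp only [pd] at hc2 ⊢
  rw [hc2.fderiv]
  simp [Vk, vec, pd]

lemma pd_comp2 {f : E3 × ℝ × E3 → ℝ} (hf : ContDiff ℝ 2 f) {u : E3 → ℝ} (hu : Sm u) (k : Fin 3) :
    ∀ y ∈ ball (0 : E3) 10, pd k (fun z => fderiv ℝ f (z, u z, grad u z) (Vk u k z)) y =
      fderiv ℝ (fderiv ℝ f) (y, u y, grad u y) (Vk u k y) (Vk u k y)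
      + fderiv ℝ f (y, u y, grad u y) (0, 1, 0) * pd k (pd k u) y
      + ∑ p, fp f u p y * pd k (pd k (pd p u)) y := by
  intro y hy
  have h3 := hasFDerivAt_vec (fun p => (hu.pd p).diff hy)
  have h := (hasFDerivAt_id y).prodMk ((hu.diff hy).hasFDerivAt.prodMk h3)
  have hfd : HasFDerivAt (fderiv ℝ f) (fderiv ℝ (fderiv ℝ f) (y, u y, grad u y)) (y, u y, grad u y) := by
    have : ContDiff ℝ 1 (fderiv ℝ f) := hf.fderiv_right (by norm_num)
    exact (this.differentiable (by norm_num) _).hasFDerivAt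
  have h4 := hasFDerivAt_vec (fun p => ((hu.pd p).pd k).diff hy)
  have h5 := (hasFDerivAt_const (EuclideanSpace.single k (1 : ℝ) : E3) y).prodMk
    (((hu.pd k).diff hy).hasFDerivAt.prodMk h4)
  have hV : HasFDerivAt (Vk u k) _ y := h5
  simp only [fp, grad_eq] at hfd ⊢
  have hc0 := hfd.comp y h
  have hc : HasFDerivAt (fun z => fderiv ℝ f (z, u z, vec fun p => pd p u z)) _ y := hc0
  have hfin := hc.clm_apply hV
  rw [pd, hfin.fderiv]
  have hsplit : ∀ (L : E3 × ℝ × E3 →L[ℝ] ℝ) (a : ℝ) (q : Fin 3 → ℝ),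
      L (0, a, vec q) = L (0, 1, 0) * a + ∑ p, L (0, 0, EuclideanSpace.single p 1) * q p := by
    intro L a q
    have : ((0 : E3), a, vec q) = a • ((0 : E3), (1 : ℝ), (0 : E3)) +
        ∑ p, q p • ((0 : E3), (0 : ℝ), (EuclideanSpace.single p (1 : ℝ) : E3)) := by
      simp [vec, Fin.sum_univ_three]
    rw [this, map_add, map_sum]
    simp only [map_smul, smul_eq_mul, mul_comm]
  have e1 := hsplit (fderiv ℝ f (y, u y, vec fun p => pd p u y)) (pd k (pd k u) y)
    (fun p => pd k (pd k (pd p u)) y)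
  rw [add_assoc, ← e1, ContinuousLinearMap.add_apply, add_comm]
  congr 1

lemma pd_lap {u : E3 → ℝ} (hu : Sm u) (j : Fin 3) :
    ∀ y ∈ ball (0 : E3) 10, pd j (lap u) y = lap (pd j u) y := by
  intro y hy
  rw [lap_eq, lap_eq, pd_sum3 (fun i => ((hu.pd i).pd i).diff hy)]
  refine Finset.sum_congr rfl fun k _ => ?_
  rw [pd_comm (hu.pd k) j k y hy]
  exact pd_congr (pd_comm hu j k) k y hy

lemma sg_sum (u : E3 → ℝ) (x : E3) (A : Fin 3 → Fin 3 → ℝ) :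
    ∑ i, ∑ j, sg u x i j * A i j =
      lap u x * ∑ i, A i i - ∑ i, ∑ j, pd i (pd j u) x * A i j := by
  simp [sg, hess, Fin.sum_univ_three, Matrix.one_apply]
  ring

lemma sigma2_eq {u : E3 → ℝ} (hu : Sm u) : ∀ y ∈ ball (0 : E3) 10,
    sigma2 (hess u y) = (1/2) * (lap u y * lap u y
      - ∑ i, ∑ j, pd i (pd j u) y * pd i (pd j u) y) := by
  intro y hy
  have e1 : (hess u y).trace = lap u y := by simp [lap, Matrix.trace]
  have e2 : (hess u y * hess u y).trace = ∑ i, ∑ j, pd i (pd j u) y * pd i (pd j u) y := by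
    simp only [Matrix.trace, Matrix.diag, Matrix.mul_apply, hess, Matrix.of_apply]
    exact Finset.sum_congr rfl fun i _ => Finset.sum_congr rfl fun j _ => by
      rw [pd_comm hu j i y hy]
  rw [sigma2, e1, e2]; ring

lemma fderiv_bounds {f : E3 × ℝ × E3 → ℝ} {K : ℝ}
    (hb : ∀ z, ∀ k : ℕ, k ≤ 2 → ‖iteratedFDeriv ℝ k f z‖ ≤ K) (z v : E3 × ℝ × E3) :
    |fderiv ℝ f z v| ≤ K * ‖v‖ ∧ |fderiv ℝ (fderiv ℝ f) z v v| ≤ K * ‖v‖^2 := by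
  constructor
  · have h := hb z 1 (by norm_num)
    rw [norm_iteratedFDeriv_one] at h
    exact ((fderiv ℝ f z).le_opNorm v).trans (by gcongr)
  · have h := hb z 2 le_rfl
    have h2 := (iteratedFDeriv ℝ 2 f z).le_opNorm (fun _ => v)
    rw [iteratedFDeriv_two_apply] at h2
    simp only [Fin.prod_univ_two] at h2
    refine h2.trans ?_
    rw [← sq]
    gcongr

/-- Combination of the scalar estimates at a point. -/
lemma final_arith (K s F R X Y D Q U G : ℝ) (hK : 1 ≤ K) (hs : 0 < s) (hF : 1 / K ≤ F)
    (hKs : 1 ≤ K * s)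
    (hX : X = Q + D + U * s + Y) (hQ : -(100/F) * G ≤ Q - (101/100)/s * R)
    (hG0 : 0 ≤ G) (hG : G ≤ 3 * (K^3 * s)^2) (hD : -(3 * (K * (K^2*s)^2)) ≤ D) (hU : -K ≤ U) :
    (1/100) * (s⁻¹^2 * R) - (300*K^7+3*K^5+K^2) * s + s⁻¹ * Y ≤ s⁻¹ * X - s⁻¹^2 * R := by
  have hK0 : 0 < K := by linarith
  have hF0 : 0 < F := lt_of_lt_of_le (by positivity) hF
  have h1 : 100/F ≤ 100*K := by
    rw [div_le_iff₀ hF0]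
    rw [div_le_iff₀ hK0] at hF
    linarith
  have h2 : (100/F) * G ≤ 100*K * (3 * (K^3 * s)^2) := by gcongr
  have h3 : -(K^2*s^2) ≤ U * s := by
    have a : -K * s ≤ U * s := by gcongr
    have b : (K * s) * 1 ≤ (K * s) * (K * s) := by gcongr
    linarith
  have h4 : (101/100)/s * R - (300*K^7+3*K^5+K^2) * s^2 + Y ≤ X := by
    rw [hX]; linarith
  have h5 := mul_le_mul_of_nonneg_left h4 (inv_nonneg.2 hs.le)
  have e1 : s⁻¹ * ((101/100)/s * R - (300*K^7+3*K^5+K^2) * s^2 + Y) =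
    (101/100) * (s⁻¹^2 * R) - (300*K^7+3*K^5+K^2) * s + s⁻¹ * Y := by
    field_simp
  rw [e1] at h5
  linarith

/-- Lemma 3: with `b = log Δu`, one has
`σ₂^{ij} b_{ij} ≥ (1/100) σ₂^{ij} b_i b_j − C Δu + Σᵢ f_{uᵢ} bᵢ` on `B₁₀`. -/
theorem stmt_3 :
    ∀ K : ℝ, 1 ≤ K → ∃ C : ℝ, 0 < C ∧
      ∀ (f : E3 × ℝ × E3 → ℝ) (u : E3 → ℝ), Hyp K f u →
        ∀ x ∈ ball (0 : E3) 10,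
          ∑ i, ∑ j, sg u x i j * pd i (pd j (fun y => Real.log (lap u y))) x ≥
            (1 / 100) * (∑ i, ∑ j, sg u x i j *
                pd i (fun y => Real.log (lap u y)) x * pd j (fun y => Real.log (lap u y)) x)
              - C * lap u x
              + ∑ i, fp f u i x * pd i (fun y => Real.log (lap u y)) x := by
  intro K hK
  refine ⟨300*K^7+3*K^5+K^2, by positivity, ?_⟩
  rintro f u ⟨hf, hfK, hfb, hu', heq, hlap, hbd⟩ x hx
  have hK0 : 0 < K := by linarith
  have hu : Sm u := hu'
  have hw : Sm (lap u) := hu.lap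
  have hh : ∀ i j, Sm (pd i (pd j u)) := fun i j => (hu.pd j).pd i
  set s := lap u x with hs
  have hs0 : 0 < s := hlap x hx
  set F := f (x, u x, grad u x) with hF
  have hFK : 1 / K ≤ F := hfK _
  have hF0 : 0 < F := lt_of_lt_of_le (by positivity) hFK
  set T : Fin 3 → Fin 3 → Fin 3 → ℝ := fun i j k => pd k (pd i (pd j u)) x with hT
  have hT1 : ∀ i j k, T i j k = T j i k := fun i j k => pd_congr (pd_comm hu i j) k x hx
  have hT2 : ∀ i j k, T i j k = T i k j := by
    intro i j k
    have a1 := pd_comm (hu.pd j) k i x hx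
    have a2 := pd_comm (hu.pd k) j i x hx
    have a3 := pd_congr (pd_comm hu k j) i x hx
    simp only [hT]
    rw [a1, a2, a3]
  have htr : ∀ k, ∑ a, T a a k = pd k (lap u) x := by
    intro k
    rw [lap_eq, pd_sum3 (fun i => (hh i i).diff hx)]
  have hGeq : ∀ y ∈ ball (0 : E3) 10, f (y, u y, grad u y) =
      (1/2) * (lap u y * lap u y - ∑ i, ∑ j, pd i (pd j u) y * pd i (pd j u) y) :=
    fun y hy => by rw [← heq y hy, sigma2_eq hu y hy]
  have hG1 : ∀ k, ∀ y ∈ ball (0 : E3) 10, fderiv ℝ f (y, u y, grad u y) (Vk u k y) =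
      lap u y * pd k (lap u) y - ∑ i, ∑ j, pd i (pd j u) y * pd k (pd i (pd j u)) y := by
    intro k y hy
    rw [← pd_comp hf hu k y hy, pd_congr hGeq k y hy]
    exact pd_quad hw hh k y hy
  have hG2 : ∀ k, fderiv ℝ (fderiv ℝ f) (x, u x, grad u x) (Vk u k x) (Vk u k x)
      + fderiv ℝ f (x, u x, grad u x) (0, 1, 0) * pd k (pd k u) x
      + ∑ p, fp f u p x * pd k (pd k (pd p u)) x =
      s * pd k (pd k (lap u)) x + (pd k (lap u) x)^2
        - ∑ i, ∑ j, (pd i (pd j u) x * pd k (pd k (pd i (pd j u))) x + (T i j k)^2) := by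
    intro k
    rw [← pd_comp2 hf hu k x hx, pd_congr (hG1 k) k x hx]
    exact pd_quad2 hw hh k x hx
  have hHsq : s^2 - ∑ i, ∑ j, (pd i (pd j u) x)^2 = 2 * F := by
    have := hGeq x hx
    rw [hF, this]
    simp only [hs, ← sq]; ring
  have hg : ∀ k, ∑ i, ∑ j, sg u x i j * T i j k = fderiv ℝ f (x, u x, grad u x) (Vk u k x) := by
    intro k
    rw [hG1 k x hx, sg_sum u x (fun i j => T i j k), htr k]
  -- size of the Laplacian
  have hsum0 : 0 ≤ ∑ i, ∑ j, (pd i (pd j u) x)^2 := by positivity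
  have hKs : 1 ≤ K * s := by
    have h1 : 2 * (1/K) ≤ s^2 := by linarith
    have h2 : K^2 * (2 * (1/K)) ≤ K^2 * s^2 := by gcongr
    have h3 : K^2 * (2 * (1/K)) = 2 * K := by field_simp
    have h4 : (1:ℝ)^2 ≤ (K*s)^2 := by rw [mul_pow]; linarith
    exact le_of_sq_le_sq h4 (by positivity)
  have hVn : ∀ k, ‖Vk u k x‖ ≤ K^2 * s := by
    intro k
    have hb1 : K ≤ K^2 * s := by
      have : K * 1 ≤ K * (K * s) := by gcongr
      linarith
    have hb2 : s ≤ K^2 * s := by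
      have : 1 * s ≤ K^2 * s := by gcongr; nlinarith
      linarith
    have hb := hbd x hx
    have hgr : ‖grad u x‖ ≤ K := by linarith [abs_nonneg (u x)]
    refine norm_prod_le_iff.2 ⟨?_, norm_prod_le_iff.2 ⟨?_, ?_⟩⟩
    · simp only [Vk, EuclideanSpace.norm_single, norm_one]
      linarith
    · have h1 := PiLp.norm_apply_le (grad u x) k
      rw [grad_eq, vec_apply, ← grad_eq] at h1
      exact h1.trans (hgr.trans hb1)
    · refine le_trans ?_ hb2
      simp only [Vk]
      have h1 := norm_vec_sq (fun p => pd k (pd p u) x)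
      have h2 : ∑ p, (pd k (pd p u) x)^2 ≤ ∑ i, ∑ j, (pd i (pd j u) x)^2 :=
        Finset.single_le_sum (f := fun i => ∑ j, (pd i (pd j u) x)^2)
          (fun i _ => by positivity) (Finset.mem_univ k)
      exact le_of_sq_le_sq (by rw [h1]; linarith) hs0.le
  -- the algebraic inequality
  have halg := alg_gen (hess u x) (fun i j => pd_comm hu i j x hx) T s F hT1 hT2 rfl hs0 hF0 hHsq
  have hsgdef : s • (1 : Matrix (Fin 3) (Fin 3) ℝ) - hess u x = sg u x := rfl
  rw [hsgdef] at halg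
  simp only [hg, htr] at halg
  -- second-order identity
  have hW : ∀ i j, pd i (pd j (lap u)) x = ∑ k, pd k (pd k (pd i (pd j u))) x := by
    intro i j
    rw [pd_congr (pd_lap hu j) i x hx, pd_lap (hu.pd j) i x hx, lap_eq]
  have hP : ∀ p, pd p (lap u) x = ∑ k, pd k (pd k (pd p u)) x := by
    intro p
    rw [pd_lap hu p x hx, lap_eq]
  have hX : ∑ i, ∑ j, sg u x i j * pd i (pd j (lap u)) x =
      (∑ i, ∑ j, ∑ k, (T i j k)^2 - ∑ k, (pd k (lap u) x)^2)
      + ∑ k, fderiv ℝ (fderiv ℝ f) (x, u x, grad u x) (Vk u k x) (Vk u k x)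
      + fderiv ℝ f (x, u x, grad u x) (0, 1, 0) * s
      + ∑ p, fp f u p x * pd p (lap u) x := by
    rw [sg_sum u x (fun i j => pd i (pd j (lap u)) x), ← hs]
    have e0 := hG2 0
    have e1 := hG2 1
    have e2 := hG2 2
    have es : s = ∑ k, pd k (pd k u) x := by rw [hs, lap_eq]
    have eU : fderiv ℝ f (x, u x, grad u x) (0, 1, 0) * s =
        ∑ k, fderiv ℝ f (x, u x, grad u x) (0, 1, 0) * pd k (pd k u) x := by
      rw [es, Finset.mul_sum]
    have eY : ∑ p, fp f u p x * pd p (lap u) x =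
        ∑ p, fp f u p x * ∑ k, pd k (pd k (pd p u)) x := by simp only [hP]
    have eW : ∑ i, ∑ j, pd i (pd j u) x * pd i (pd j (lap u)) x =
        ∑ i, ∑ j, pd i (pd j u) x * ∑ k, pd k (pd k (pd i (pd j u))) x := by simp only [hW]
    rw [eU, eY, eW]
    clear_value T s
    simp only [Fin.sum_univ_three] at e0 e1 e2 ⊢
    linarith
  -- bounds
  have hbf := fun v => fderiv_bounds hfb (x, u x, grad u x) v
  have hGb : ∑ k, (fderiv ℝ f (x, u x, grad u x) (Vk u k x))^2 ≤ 3 * (K^3*s)^2 := by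
    have : ∀ k, (fderiv ℝ f (x, u x, grad u x) (Vk u k x))^2 ≤ (K^3*s)^2 := by
      intro k
      apply sq_le_sq'
      all_goals
        have h1 := (hbf (Vk u k x)).1
        have h2 : K * ‖Vk u k x‖ ≤ K * (K^2*s) := by gcongr; exact hVn k
        have h3 := abs_le.1 (h1.trans h2)
        linarith [h3.1, h3.2]
    simp only [Fin.sum_univ_three]
    linarith [this 0, this 1, this 2]
  have hDb : -(3 * (K * (K^2*s)^2)) ≤
      ∑ k, fderiv ℝ (fderiv ℝ f) (x, u x, grad u x) (Vk u k x) (Vk u k x) := by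
    have : ∀ k, -(K * (K^2*s)^2) ≤
        fderiv ℝ (fderiv ℝ f) (x, u x, grad u x) (Vk u k x) (Vk u k x) := by
      intro k
      have h1 := (hbf (Vk u k x)).2
      have h2 : K * ‖Vk u k x‖^2 ≤ K * (K^2*s)^2 := by gcongr; exact hVn k
      exact (abs_le.1 (h1.trans h2)).1
    simp only [Fin.sum_univ_three]
    linarith [this 0, this 1, this 2]
  have hUb : -K ≤ fderiv ℝ f (x, u x, grad u x) (0, 1, 0) := by
    have h1 := (hbf (0, 1, 0)).1
    have h2 : ‖((0 : E3), (1 : ℝ), (0 : E3))‖ = 1 := by simp [Prod.norm_def]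
    rw [h2, mul_one] at h1
    exact (abs_le.1 h1).1
  have hfin := final_arith K s F _ _ _ _ _ _ _ hK hs0 hFK hKs hX halg
    (Finset.sum_nonneg fun k _ => sq_nonneg _) hGb hDb hUb
  simp only [pd_log2 hw hlap _ _ x hx, pd_log hw hlap _ x hx]
  rw [ge_iff_le]
  refine le_trans (le_of_eq ?_) (hfin.trans (le_of_eq ?_))
  · simp only [← hs, Fin.sum_univ_three]; ring
  · simp only [← hs, Fin.sum_univ_three]; ring
end
end

section
/- Let λ₁ ≥ λ₂ ≥ λ₃ be real numbers with σ₁(λ) > 0 and σ₂(λ) > 0, and set σ₁ = λ₁+λ₂+λ₃, σ₂^{11} = λ₂+λ₃, σ₂^{22} = λ₁+λ₃, σ₂^{33} = λ₁+λ₂ (all of which are positive under these hypotheses). Then for every ε with 0 < ε ≤ 2/5 and all real a, b: (2(σ₂^{11}+σ₂^{22})/(σ₁σ₂^{11}))·a² + (2(σ₂^{11}+σ₂^{33})/(σ₁σ₂^{11}))·b² + (4λ₁/(σ₁σ₂^{11}))·a·b ≥ 2εσ₁(a+b)²/(σ₁σ₂^{11}). -/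
/-- Claim 1: for ordered `λ ∈ Γ₂ ⊂ ℝ³`, `0 < ε ≤ 2/5`, and all real `a, b`:
`(2(σ₂^{11}+σ₂^{22})/(σ₁σ₂^{11})) a² + (2(σ₂^{11}+σ₂^{33})/(σ₁σ₂^{11})) b²
  + (4λ₁/(σ₁σ₂^{11})) ab ≥ 2εσ₁(a+b)²/(σ₁σ₂^{11})`. -/
theorem stmt_4 (l1 l2 l3 : ℝ) (h12 : l2 ≤ l1) (h23 : l3 ≤ l2)
    (hs1 : 0 < l1 + l2 + l3) (hs2 : 0 < l1 * l2 + l1 * l3 + l2 * l3)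
    (ε : ℝ) (hε0 : 0 < ε) (hε : ε ≤ 2 / 5) (a b : ℝ) :
    2 * ((l2 + l3) + (l1 + l3)) / ((l1 + l2 + l3) * (l2 + l3)) * a ^ 2
      + 2 * ((l2 + l3) + (l1 + l2)) / ((l1 + l2 + l3) * (l2 + l3)) * b ^ 2
      + 4 * l1 / ((l1 + l2 + l3) * (l2 + l3)) * a * b
    ≥ 2 * ε * (l1 + l2 + l3) * (a + b) ^ 2 / ((l1 + l2 + l3) * (l2 + l3)) := by
  have hl1 : 0 < l1 := by linarith
  have ht : 0 < l2 + l3 := by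
    by_contra hc
    push Not at hc
    nlinarith [sq_nonneg (l2 - l3), mul_nonneg (neg_nonneg.2 hc) hs1.le, sq_nonneg (l2 + l3)]
  have hlt : 0 < l1 * (l2 + l3) := mul_pos hl1 ht
  have hA' : 0 < (3 / 5 * (l1 + l2 + l3) + l3) * (3 / 5 * (l1 + l2 + l3) + l2)
      - (l1 - 2 / 5 * (l1 + l2 + l3)) ^ 2 := by
    nlinarith [sq_nonneg (l2 + l3)]
  have hA : 0 < 3 / 5 * (l1 + l2 + l3) + l3 := by
    have hB : 0 < 3 / 5 * (l1 + l2 + l3) + l2 := by linarith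
    have h : 0 < (3 / 5 * (l1 + l2 + l3) + l3) * (3 / 5 * (l1 + l2 + l3) + l2) := by
      linarith [sq_nonneg (l1 - 2 / 5 * (l1 + l2 + l3))]
    exact pos_of_mul_pos_left h hB.le
  have key : 0 ≤ (3 / 5 * (l1 + l2 + l3) + l3) * a ^ 2 + (3 / 5 * (l1 + l2 + l3) + l2) * b ^ 2
      + 2 * (l1 - 2 / 5 * (l1 + l2 + l3)) * a * b := by
    refine nonneg_of_mul_nonneg_right (b := _) ?_ hA
    have h1 := sq_nonneg ((3 / 5 * (l1 + l2 + l3) + l3) * a + (l1 - 2 / 5 * (l1 + l2 + l3)) * b)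
    have h2 := mul_nonneg hA'.le (sq_nonneg b)
    linarith
  have he : 0 ≤ (2 / 5 - ε) * ((l1 + l2 + l3) * (a + b) ^ 2) :=
    mul_nonneg (by linarith) (by positivity)
  have hD : 0 < (l1 + l2 + l3) * (l2 + l3) := mul_pos hs1 ht
  have e1 : 2 * ((l2 + l3) + (l1 + l3)) / ((l1 + l2 + l3) * (l2 + l3)) * a ^ 2
      + 2 * ((l2 + l3) + (l1 + l2)) / ((l1 + l2 + l3) * (l2 + l3)) * b ^ 2
      + 4 * l1 / ((l1 + l2 + l3) * (l2 + l3)) * a * b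
      = (2 * ((l2 + l3) + (l1 + l3)) * a ^ 2 + 2 * ((l2 + l3) + (l1 + l2)) * b ^ 2
        + 4 * l1 * a * b) / ((l1 + l2 + l3) * (l2 + l3)) := by
    generalize (l1 + l2 + l3) * (l2 + l3) = D
    ring
  rw [e1, ge_iff_le]
  apply div_le_div_of_nonneg_right _ hD.le
  linarith
end

section
/- Let λ₁ ≥ λ₂ ≥ λ₃ be real numbers with σ₁(λ) > 0 and σ₂(λ) > 0, and set σ₁ = λ₁+λ₂+λ₃, σ₂^{11} = λ₂+λ₃, σ₂^{22} = λ₁+λ₃, σ₂^{33} = λ₁+λ₂ (all of which are positive under these hypotheses). Then for every δ with 0 < δ ≤ 1/20 and all real a, b: (2(σ₂^{11}+σ₂^{22})/(σ₁σ₂^{11}))·a² + (2(σ₂^{11}+σ₂^{33})/(σ₁σ₂^{11}))·b² + (4λ₁/(σ₁σ₂^{11}))·a·b ≥ (1+δ)·((λ₂−λ₁)a + (λ₃−λ₁)b)²/(σ₁²·σ₂^{11}). -/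
/-- Claim 2: for ordered `λ ∈ Γ₂ ⊂ ℝ³`, `0 < δ ≤ 1/20`, and all real `a, b`:
`(2(σ₂^{11}+σ₂^{22})/(σ₁σ₂^{11})) a² + (2(σ₂^{11}+σ₂^{33})/(σ₁σ₂^{11})) b²
  + (4λ₁/(σ₁σ₂^{11})) ab ≥ (1+δ)((λ₂−λ₁)a + (λ₃−λ₁)b)²/(σ₁²σ₂^{11})`. -/
theorem stmt_5 (l1 l2 l3 : ℝ) (h12 : l2 ≤ l1) (h23 : l3 ≤ l2)
    (hs1 : 0 < l1 + l2 + l3) (hs2 : 0 < l1 * l2 + l1 * l3 + l2 * l3)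
    (δ : ℝ) (hδ0 : 0 < δ) (hδ : δ ≤ 1 / 20) (a b : ℝ) :
    2 * ((l2 + l3) + (l1 + l3)) / ((l1 + l2 + l3) * (l2 + l3)) * a ^ 2
      + 2 * ((l2 + l3) + (l1 + l2)) / ((l1 + l2 + l3) * (l2 + l3)) * b ^ 2
      + 4 * l1 / ((l1 + l2 + l3) * (l2 + l3)) * a * b
    ≥ (1 + δ) * ((l2 - l1) * a + (l3 - l1) * b) ^ 2
        / ((l1 + l2 + l3) ^ 2 * (l2 + l3)) := by
  have hm : 0 < l1 := by linarith
  have hs : 0 < l2 + l3 := by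
    by_contra h
    push Not at h
    nlinarith [mul_nonneg hs1.le (neg_nonneg.mpr h), sq_nonneg (l2 - l3), sq_nonneg (l2 + l3)]
  have hl2 : 0 < l2 := by linarith
  obtain ⟨k, hk⟩ : ∃ k, k = 1 + δ := ⟨_, rfl⟩
  have hk1 : 0 < k := by linarith
  have hk2 : k ≤ 21 / 20 := by linarith
  have hα : 0 < 2 * (l1 + l2 + l3) * (l1 + l2 + 2 * l3) - k * (l2 - l1) ^ 2 := by
    have h1 : l1 * (l1 - l2) ≤ (l1 + l2 + l3) * (l1 - l2) :=
      mul_le_mul_of_nonneg_right (by linarith) (by linarith)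
    have h2 : 0 < (l1 + l2 + l3) * (2 * (l2 + l3)) := by positivity
    have h3 : (l1 - l2) * (l1 - l2) ≤ l1 * (l1 - l2) :=
      mul_le_mul_of_nonneg_right (by linarith) (by linarith)
    have h4 : k * (l2 - l1) ^ 2 ≤ 21 / 20 * (l2 - l1) ^ 2 :=
      mul_le_mul_of_nonneg_right hk2 (sq_nonneg _)
    nlinarith [sq_nonneg (l2 - l1)]
  have hdet : 0 ≤ 2 * (l1 + l2 + l3) * (2 * (l2 + l3) * (l1 + l2 + l3)
        + (l1 * l2 + l1 * l3 + l2 * l3))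
      - k * (2 * (l2 + l3) ^ 3 + 2 * l1 * (l2 + l3) ^ 2 + 3 * l1 ^ 2 * (l2 + l3)
        - 5 * (l2 + l3) * (l1 * l2 + l1 * l3 + l2 * l3)) := by
    generalize l1 * l2 + l1 * l3 + l2 * l3 = q at hs2
    rw [show l1 + l2 + l3 = l1 + (l2 + l3) by ring] at *
    generalize l2 + l3 = s at hs
    have e1 : k * (2 * s ^ 3 + 2 * l1 * s ^ 2 + 3 * l1 ^ 2 * s)
      ≤ 21 / 20 * (2 * s ^ 3 + 2 * l1 * s ^ 2 + 3 * l1 ^ 2 * s) :=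
      mul_le_mul_of_nonneg_right hk2 (by positivity)
    have e2 : 0 < k * (5 * s * q) := by positivity
    have e3 : 0 < s ^ 3 := by positivity
    have e4 : 0 < l1 * s ^ 2 := by positivity
    have e5 : 0 < l1 ^ 2 * s := by positivity
    have e6 : 0 < l1 * q := by positivity
    have e7 : 0 < s * q := by positivity
    nlinarith
  have key : 0 ≤ (l1 + l2 + l3) * (2 * ((l2 + l3) + (l1 + l3)) * a ^ 2
      + 2 * ((l2 + l3) + (l1 + l2)) * b ^ 2 + 4 * l1 * a * b)
      - k * ((l2 - l1) * a + (l3 - l1) * b) ^ 2 := by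
    refine nonneg_of_mul_nonneg_right ?_ hα
    have h := mul_nonneg (mul_nonneg hs1.le hdet) (sq_nonneg b)
    have h2 := sq_nonneg ((2 * (l1 + l2 + l3) * (l1 + l2 + 2 * l3) - k * (l2 - l1) ^ 2) * a
      + (2 * (l1 + l2 + l3) * l1 - k * (l2 - l1) * (l3 - l1)) * b)
    linear_combination 2 * h + h2
  rw [← hk, ge_iff_le, ← sub_nonneg]
  have hd : 0 < (l1 + l2 + l3) ^ 2 * (l2 + l3) := by positivity
  have := div_nonneg key hd.le
  refine this.trans_eq ?_
  have hs1n := hs1.ne'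
  have hsn := hs.ne'
  field_simp
end

section
/- Let λ₁ ≥ λ₂ ≥ λ₃ be real numbers with σ₁(λ) > 0 and σ₂(λ) > 0, and set σ₁ = λ₁+λ₂+λ₃, σ₂^{11} = λ₂+λ₃, σ₂^{22} = λ₁+λ₃, σ₂^{33} = λ₁+λ₂. Then for every δ with 0 < δ ≤ 1/20: [2(σ₂^{11}+σ₂^{22})σ₁ − (1+δ)(λ₁−λ₂)²]·[2(σ₂^{11}+σ₂^{33})σ₁ − (1+δ)(λ₁−λ₃)²] ≥ [2λ₁σ₁ − (1+δ)(λ₁−λ₂)(λ₁−λ₃)]². -/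
/-- The key elementary inequality in Claim 2: for ordered `λ ∈ Γ₂ ⊂ ℝ³` and `0 < δ ≤ 1/20`:
`[2(σ₂^{11}+σ₂^{22})σ₁ − (1+δ)(λ₁−λ₂)²]·[2(σ₂^{11}+σ₂^{33})σ₁ − (1+δ)(λ₁−λ₃)²]
  ≥ [2λ₁σ₁ − (1+δ)(λ₁−λ₂)(λ₁−λ₃)]²`. -/
theorem stmt_6 (l1 l2 l3 : ℝ) (h12 : l2 ≤ l1) (h23 : l3 ≤ l2)
    (hs1 : 0 < l1 + l2 + l3) (hs2 : 0 < l1 * l2 + l1 * l3 + l2 * l3)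
    (δ : ℝ) (hδ0 : 0 < δ) (hδ : δ ≤ 1 / 20) :
    (2 * ((l2 + l3) + (l1 + l3)) * (l1 + l2 + l3) - (1 + δ) * (l1 - l2) ^ 2)
      * (2 * ((l2 + l3) + (l1 + l2)) * (l1 + l2 + l3) - (1 + δ) * (l1 - l3) ^ 2)
    ≥ (2 * l1 * (l1 + l2 + l3) - (1 + δ) * (l1 - l2) * (l1 - l3)) ^ 2 := by
  have ha : 0 < l1 := by linarith
  have hp : 0 < l2 + l3 := by
    have h1 : 0 < (l2 + l3) * (l1 + (l2 + l3) / 4) := by nlinarith [sq_nonneg (l2 - l3)]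
    exact pos_of_mul_pos_left h1 (by linarith)
  obtain ⟨s, hs⟩ : ∃ s, s = l1 + l2 + l3 := ⟨_, rfl⟩
  obtain ⟨p, hpd⟩ : ∃ p, p = l2 + l3 := ⟨_, rfl⟩
  obtain ⟨q, hq⟩ : ∃ q, q = l1 * l2 + l1 * l3 + l2 * l3 := ⟨_, rfl⟩
  have hs0 : 0 < s := hs ▸ hs1
  have hp0 : 0 < p := hpd ▸ hp
  have hq0 : 0 < q := hq ▸ hs2
  have h4 : 0 < 4 * s - 3 * p := by rw [hs, hpd]; linarith
  have hc : 0 < 4 - 3 * (1 + δ) := by linarith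
  have hF : 0 ≤ 2 * s * (2 * s * q + 5 * (1 + δ) * p * q
      + p * (s ^ 2 * (4 - 3 * (1 + δ)) + (1 + δ) * p * (4 * s - 3 * p))) := by positivity
  rw [ge_iff_le, ← sub_nonneg]
  refine hF.trans_eq ?_
  rw [hs, hpd, hq]
  ring
end
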